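/- arXiv:0812.2321 — 2 statements merged into one kernel-verified Lean document; each statement's English description precedes it below -/
import Mathlib

section
/- For every real s > 0, the function s ↦ I₂(s) + I₁(s) is differentiable at s and its derivative equals -(1/4)·I₀(s) + 1/(2√(1 + s)). -/
open Real

/-- `I_ν(s) = (1/√2) ∫₋₁¹ tᵛ/(√(t+1)√(t²+s)) dt`. -/
noncomputable def Inu (ν : ℕ) (s : ℝ) : ℝ :=
  (1 / Real.sqrt 2) * ∫ t in (-1 : ℝ)..1, t ^ ν / (Real.sqrt (t + 1) * Real.sqrt (t ^ 2 + s))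

open MeasureTheory in
lemma intervalIntegrable_Inu_integrand (ν : ℕ) {s : ℝ} (hs : 0 < s) :
    IntervalIntegrable (fun t : ℝ => t ^ ν / (Real.sqrt (t + 1) * Real.sqrt (t ^ 2 + s)))
      volume (-1) 1 := by
  have h : IntervalIntegrable (fun t : ℝ => (Real.sqrt (t + 1))⁻¹) volume (-1) 1 := by
    have h0 : IntervalIntegrable (fun t : ℝ => t ^ (-(1 / 2) : ℝ)) volume 0 2 :=
      intervalIntegral.intervalIntegrable_rpow' (by norm_num)
    have h1 := h0.comp_add_right 1
    norm_num at h1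
    refine h1.congr fun t ht => ?_
    rw [Set.uIoc_of_le (by norm_num)] at ht
    rw [Real.sqrt_eq_rpow, Real.rpow_neg (by linarith [ht.1])]
  have hc : Continuous fun t : ℝ => t ^ ν / Real.sqrt (t ^ 2 + s) :=
    (continuous_pow ν).div (by fun_prop) fun t => (Real.sqrt_pos.2 (by positivity)).ne'
  refine (h.mul_continuousOn hc.continuousOn).congr fun t _ => ?_
  simp only [div_eq_mul_inv, mul_inv]
  ring

lemma Inu_two_add_Inu_one {s : ℝ} (hs : 0 < s) :
    Inu 2 s + Inu 1 s =
      (1 / Real.sqrt 2) * ∫ t in (-1 : ℝ)..1, t * Real.sqrt (t + 1) / Real.sqrt (t ^ 2 + s) := by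
  unfold Inu
  rw [← mul_add, ← intervalIntegral.integral_add (intervalIntegrable_Inu_integrand 2 hs)
    (intervalIntegrable_Inu_integrand 1 hs)]
  congr 1
  refine intervalIntegral.integral_congr_ae (Filter.Eventually.of_forall fun t ht => ?_)
  rw [Set.uIoc_of_le (by norm_num)] at ht
  have h1 : 0 < t + 1 := by linarith [ht.1]
  have h2 : 0 < Real.sqrt (t + 1) := Real.sqrt_pos.2 h1
  have h3 : 0 < Real.sqrt (t ^ 2 + s) := Real.sqrt_pos.2 (by positivity)
  have h4 := Real.sq_sqrt h1.le
  field_simp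
  rw [h4]

lemma continuous_mul_sqrt_div_sqrt_pow (n : ℕ) {s : ℝ} (hs : 0 < s) :
    Continuous fun t : ℝ => t * Real.sqrt (t + 1) / Real.sqrt (t ^ 2 + s) ^ n :=
  Continuous.div (by fun_prop) (by fun_prop) fun t =>
    (pow_pos (Real.sqrt_pos.2 (by positivity)) n).ne'

lemma hasDerivAt_mul_sqrt_div_sqrt (t : ℝ) {x : ℝ} (hx : 0 < x) :
    HasDerivAt (fun x => t * Real.sqrt (t + 1) / Real.sqrt (t ^ 2 + x))
      (-(1 / 2) * (t * Real.sqrt (t + 1) / Real.sqrt (t ^ 2 + x) ^ 3)) x := by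
  have h0 : 0 < t ^ 2 + x := by positivity
  have h3 : 0 < Real.sqrt (t ^ 2 + x) := Real.sqrt_pos.2 h0
  have h := (hasDerivAt_const x (t * Real.sqrt (t + 1))).div
    (((hasDerivAt_id x).const_add (t ^ 2)).sqrt h0.ne') h3.ne'
  refine h.congr_deriv ?_
  simp only [id]
  field_simp
  ring

lemma hasDerivAt_integral_mul_sqrt_div_sqrt {s : ℝ} (hs : 0 < s) :
    HasDerivAt (fun x => ∫ t in (-1 : ℝ)..1, t * Real.sqrt (t + 1) / Real.sqrt (t ^ 2 + x))
      (∫ t in (-1 : ℝ)..1, -(1 / 2) * (t * Real.sqrt (t + 1) / Real.sqrt (t ^ 2 + s) ^ 3)) s := by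
  have hpos : ∀ x ∈ Metric.ball s (s / 2), s / 2 < x := fun x hx => by
    rw [Metric.mem_ball, Real.dist_eq, abs_lt] at hx
    linarith [hx.1]
  have hcont : ∀ x, 0 < x →
      Continuous fun t : ℝ => t * Real.sqrt (t + 1) / Real.sqrt (t ^ 2 + x) := fun x hx => by
    simpa using continuous_mul_sqrt_div_sqrt_pow 1 hx
  refine (intervalIntegral.hasDerivAt_integral_of_dominated_loc_of_deriv_le
    (F' := fun x t => -(1 / 2) * (t * Real.sqrt (t + 1) / Real.sqrt (t ^ 2 + x) ^ 3))
    (bound := fun _ => 1 / 2 * (1 * Real.sqrt 2 / Real.sqrt (s / 2) ^ 3))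
    (Metric.ball_mem_nhds s (half_pos hs)) ?_ ((hcont s hs).intervalIntegrable _ _) ?_ ?_
    intervalIntegrable_const ?_).2
  · filter_upwards [lt_mem_nhds hs] with x hx using (hcont x hx).aestronglyMeasurable
  · exact ((continuous_mul_sqrt_div_sqrt_pow 3 hs).const_mul _).aestronglyMeasurable
  · refine Filter.Eventually.of_forall fun t ht x hx => ?_
    rw [Set.uIoc_of_le (by norm_num)] at ht
    have hx' := hpos x hx
    have hs' : 0 < Real.sqrt (s / 2) := Real.sqrt_pos.2 (half_pos hs)
    have ht' : |t| ≤ 1 := abs_le.2 ⟨ht.1.le, ht.2⟩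
    rw [norm_mul, norm_div, norm_mul, norm_pow, Real.norm_eq_abs t,
      Real.norm_of_nonneg (Real.sqrt_nonneg (t + 1)),
      Real.norm_of_nonneg (Real.sqrt_nonneg (t ^ 2 + x)), norm_neg,
      Real.norm_of_nonneg (by norm_num : (0 : ℝ) ≤ 1 / 2)]
    gcongr
    · linarith [ht.2]
    · nlinarith [sq_nonneg t]
  · exact Filter.Eventually.of_forall fun t _ x hx =>
      hasDerivAt_mul_sqrt_div_sqrt t ((half_pos hs).trans (hpos x hx))

lemma integral_mul_sqrt_div_sqrt_pow_three {s : ℝ} (hs : 0 < s) :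
    ∫ t in (-1 : ℝ)..1, t * Real.sqrt (t + 1) / Real.sqrt (t ^ 2 + s) ^ 3 =
      1 / 2 * (∫ t in (-1 : ℝ)..1, t ^ 0 / (Real.sqrt (t + 1) * Real.sqrt (t ^ 2 + s))) -
        Real.sqrt 2 / Real.sqrt (1 + s) := by
  have hi0 := (intervalIntegrable_Inu_integrand 0 hs).const_mul (1 / 2)
  have hi3 := (continuous_mul_sqrt_div_sqrt_pow 3 hs).intervalIntegrable
    (μ := MeasureTheory.volume) (-1) 1
  have hcont : Continuous fun t : ℝ => Real.sqrt (t + 1) / Real.sqrt (t ^ 2 + s) :=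
    Continuous.div (by fun_prop) (by fun_prop) fun t => (Real.sqrt_pos.2 (by positivity)).ne'
  have key := intervalIntegral.integral_eq_sub_of_hasDerivAt_of_le (by norm_num : (-1 : ℝ) ≤ 1)
    hcont.continuousOn (fun t ht => ?_) (hi0.sub hi3)
  · rw [intervalIntegral.integral_sub hi0 hi3, intervalIntegral.integral_const_mul] at key
    norm_num at key ⊢
    linarith
  · have h1 : 0 < t + 1 := by linarith [ht.1]
    have h0 : 0 < t ^ 2 + s := by positivity
    have h2 : 0 < Real.sqrt (t + 1) := Real.sqrt_pos.2 h1
    have h3 : 0 < Real.sqrt (t ^ 2 + s) := Real.sqrt_pos.2 h0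
    have h := (((hasDerivAt_id t).add_const 1).sqrt h1.ne').div
      ((((hasDerivAt_id t).pow 2).add_const s).sqrt h0.ne') h3.ne'
    refine h.congr_deriv ?_
    simp only [id, Pi.pow_apply]
    field_simp
    norm_num
    ring

/-- `(I₂ + I₁)'(s) = -(1/4) I₀(s) + 1/(2√(1+s))` for `s > 0`. -/
theorem stmt11 (s : ℝ) (hs : 0 < s) :
    HasDerivAt (fun x => Inu 2 x + Inu 1 x)
      (-(1 / 4) * Inu 0 s + 1 / (2 * Real.sqrt (1 + s))) s := by
  have h := (hasDerivAt_integral_mul_sqrt_div_sqrt hs).const_mul (1 / Real.sqrt 2)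
  rw [intervalIntegral.integral_const_mul, integral_mul_sqrt_div_sqrt_pow_three hs] at h
  refine (h.congr_of_eventuallyEq ?_).congr_deriv ?_
  · filter_upwards [lt_mem_nhds hs] with x hx using Inu_two_add_Inu_one hx
  · have h2 : 0 < Real.sqrt 2 := by positivity
    have h3 : 0 < Real.sqrt (1 + s) := by positivity
    unfold Inu
    field_simp
    ring
end

section
/- For every real s > 0, the functions I₀ and I₁ are differentiable at s and I₁'(s) = s·I₀'(s) + (1/4)·I₀(s) + 1/(2√(1 + s)). -/
open Real

/-- The singular weight `1 / √(t + 1)` is integrable on `[-1, 1]`. -/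
theorem intervalIntegrable_inv_sqrt_add_one :
    IntervalIntegrable (fun t : ℝ => (√(t + 1))⁻¹) MeasureTheory.volume (-1) 1 := by
  have h := (intervalIntegral.intervalIntegrable_rpow' (a := 0) (b := 2) (r := -(1 / 2))
    (by norm_num)).comp_add_right 1
  norm_num at h
  refine h.congr fun t ht => ?_
  rw [Set.uIoc_of_le (by norm_num)] at ht
  have : 0 ≤ t + 1 := by linarith [ht.1]
  rw [Real.sqrt_eq_rpow, ← Real.rpow_neg this]

theorem intervalIntegrable_mul_inv_sqrt_add_one {g : ℝ → ℝ} (hg : Continuous g) :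
    IntervalIntegrable (fun t => g t * (√(t + 1))⁻¹) MeasureTheory.volume (-1) 1 :=
  intervalIntegrable_inv_sqrt_add_one.continuousOn_mul hg.continuousOn

theorem continuous_pow_mul_inv_sqrt_pow (c : ℝ) (ν k : ℕ) {s : ℝ} (hs : 0 < s) :
    Continuous fun t : ℝ => c * t ^ ν * (√(t ^ 2 + s) ^ k)⁻¹ := by
  refine (by fun_prop : Continuous fun t : ℝ => c * t ^ ν).mul (Continuous.inv₀ (by fun_prop) ?_)
  intro t
  positivity

theorem Inu_eq (ν : ℕ) (s : ℝ) :
    Inu ν s = (1 / √2) * ∫ t in (-1 : ℝ)..1, 1 * t ^ ν * (√(t ^ 2 + s) ^ 1)⁻¹ * (√(t + 1))⁻¹ := by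
  unfold Inu
  congr 2
  ext t
  rw [div_eq_mul_inv, mul_inv]
  ring

theorem hasDerivAt_inv_sqrt_sq_add (t : ℝ) {x : ℝ} (hx : 0 < x) :
    HasDerivAt (fun x : ℝ => (√(t ^ 2 + x) ^ 1)⁻¹) (-(1 / 2) * (√(t ^ 2 + x) ^ 3)⁻¹) x := by
  have hpos : 0 < t ^ 2 + x := by positivity
  have h := (((hasDerivAt_id' x).const_add (t ^ 2)).sqrt hpos.ne').inv (by
    simpa using (Real.sqrt_pos.2 hpos).ne')
  simp only [pow_one]
  refine h.congr_deriv ?_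
  field_simp

/-- Differentiation under the integral sign for `Inu`. -/
theorem hasDerivAt_Inu (ν : ℕ) {s : ℝ} (hs : 0 < s) :
    HasDerivAt (Inu ν) ((1 / √2) *
      ∫ t in (-1 : ℝ)..1, -(1 / 2) * t ^ ν * (√(t ^ 2 + s) ^ 3)⁻¹ * (√(t + 1))⁻¹) s := by
  rw [show Inu ν = _ from funext (Inu_eq ν)]
  refine HasDerivAt.const_mul _ ?_
  have hball : ∀ x ∈ Metric.ball s (s / 2), s / 2 < x := by
    intro x hx
    rw [Metric.mem_ball, Real.dist_eq, abs_lt] at hx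
    linarith [hx.1]
  refine (intervalIntegral.hasDerivAt_integral_of_dominated_loc_of_deriv_le
    (bound := fun t => 1 / 2 * (√(s / 2) ^ 3)⁻¹ * (√(t + 1))⁻¹)
    (F := fun x t => 1 * t ^ ν * (√(t ^ 2 + x) ^ 1)⁻¹ * (√(t + 1))⁻¹)
    (F' := fun x t => -(1 / 2) * t ^ ν * (√(t ^ 2 + x) ^ 3)⁻¹ * (√(t + 1))⁻¹)
    (Metric.ball_mem_nhds s (half_pos hs)) ?_ ?_ ?_ ?_ ?_ ?_).2
  · exact Filter.Eventually.of_forall fun x =>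
      (by fun_prop : Measurable fun t : ℝ =>
        1 * t ^ ν * (√(t ^ 2 + x) ^ 1)⁻¹ * (√(t + 1))⁻¹).aestronglyMeasurable
  · exact intervalIntegrable_mul_inv_sqrt_add_one (continuous_pow_mul_inv_sqrt_pow 1 ν 1 hs)
  · exact (by fun_prop : Measurable fun t : ℝ =>
        -(1 / 2) * t ^ ν * (√(t ^ 2 + s) ^ 3)⁻¹ * (√(t + 1))⁻¹).aestronglyMeasurable
  · refine Filter.Eventually.of_forall fun t ht x hx => ?_
    rw [Set.uIoc_of_le (by norm_num)] at ht
    have hx' := hball x hx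
    have ht1 : |t ^ ν| ≤ 1 := by
      rw [abs_pow]
      exact pow_le_one₀ (abs_nonneg t) (abs_le.2 ⟨ht.1.le, ht.2⟩)
    have hsqrt : √(s / 2) ≤ √(t ^ 2 + x) := Real.sqrt_le_sqrt (by nlinarith [sq_nonneg t])
    have hpos : 0 < √(s / 2) := Real.sqrt_pos.2 (half_pos hs)
    have hinv : (√(t ^ 2 + x) ^ 3)⁻¹ ≤ (√(s / 2) ^ 3)⁻¹ := by gcongr
    rw [Real.norm_eq_abs, abs_mul, abs_mul, abs_mul, abs_of_nonneg (a := (√(t + 1))⁻¹)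
      (by positivity), abs_of_nonneg (a := (√(t ^ 2 + x) ^ 3)⁻¹) (by positivity), abs_neg,
      abs_of_pos (by norm_num : (0 : ℝ) < 1 / 2)]
    gcongr
    linarith
  · exact intervalIntegrable_inv_sqrt_add_one.const_mul _
  · refine Filter.Eventually.of_forall fun t _ x hx => ?_
    have hx' : 0 < x := (half_pos hs).trans (hball x hx)
    exact (((hasDerivAt_inv_sqrt_sq_add t hx').const_mul (1 * t ^ ν)).mul_const
      ((√(t + 1))⁻¹)).congr_deriv (by ring)

theorem hasDerivAt_sqrt_add_one_div_sqrt {s t : ℝ} (hs : 0 < s) (ht : -1 < t) :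
    HasDerivAt (fun t : ℝ => 1 / 2 * (√(t + 1) / √(t ^ 2 + s)))
      (-(1 / 2) * t ^ 1 * (√(t ^ 2 + s) ^ 3)⁻¹ * (√(t + 1))⁻¹
        - s * (-(1 / 2) * t ^ 0 * (√(t ^ 2 + s) ^ 3)⁻¹ * (√(t + 1))⁻¹)
        - 1 / 4 * (1 * t ^ 0 * (√(t ^ 2 + s) ^ 1)⁻¹ * (√(t + 1))⁻¹)) t := by
  have hq : 0 < t ^ 2 + s := by positivity
  have hp : 0 < t + 1 := by linarith
  have hq' := Real.sqrt_pos.2 hq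
  have hp' := Real.sqrt_pos.2 hp
  have h := ((((hasDerivAt_id' t).add_const 1).sqrt hp.ne').div
    (((hasDerivAt_pow 2 t).add_const s).sqrt hq.ne') hq'.ne').const_mul (1 / 2)
  refine h.congr_deriv ?_
  have eq := Real.sq_sqrt hq.le
  have ep := Real.sq_sqrt hp.le
  generalize √(t ^ 2 + s) = q at *
  generalize √(t + 1) = p at *
  obtain rfl : s = q ^ 2 - t ^ 2 := by linarith
  field_simp
  norm_num
  rw [ep]
  ring

theorem integral_deriv_combination {s : ℝ} (hs : 0 < s) :
    (∫ t in (-1 : ℝ)..1, -(1 / 2) * t ^ 1 * (√(t ^ 2 + s) ^ 3)⁻¹ * (√(t + 1))⁻¹)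
      - s * (∫ t in (-1 : ℝ)..1, -(1 / 2) * t ^ 0 * (√(t ^ 2 + s) ^ 3)⁻¹ * (√(t + 1))⁻¹)
      - 1 / 4 * (∫ t in (-1 : ℝ)..1, 1 * t ^ 0 * (√(t ^ 2 + s) ^ 1)⁻¹ * (√(t + 1))⁻¹)
      = 1 / 2 * (√2 / √(1 + s)) := by
  have hg (c : ℝ) (ν k : ℕ) := intervalIntegrable_mul_inv_sqrt_add_one
    (continuous_pow_mul_inv_sqrt_pow c ν k hs)
  have h0 := (hg (-(1 / 2)) 0 3).const_mul s
  have h1 := (hg 1 0 1).const_mul (1 / 4)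
  have h2 := (hg (-(1 / 2)) 1 3).sub h0
  rw [← intervalIntegral.integral_const_mul, ← intervalIntegral.integral_const_mul,
    ← intervalIntegral.integral_sub (hg _ _ _) h0, ← intervalIntegral.integral_sub h2 h1,
    intervalIntegral.integral_eq_sub_of_hasDerivAt_of_le (by norm_num) ?_
      (fun t ht => hasDerivAt_sqrt_add_one_div_sqrt hs ht.1) (h2.sub h1)]
  · norm_num
  · refine (continuous_const.mul (Continuous.div (by fun_prop) (by fun_prop) ?_)).continuousOn
    intro t
    positivity

/-- for `s > 0`, `I₀` and `I₁` are differentiable at `s` and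
`I₁'(s) = s I₀'(s) + (1/4) I₀(s) + 1/(2√(1+s))`. -/
theorem stmt13 (s : ℝ) (hs : 0 < s) :
    DifferentiableAt ℝ (Inu 0) s ∧ DifferentiableAt ℝ (Inu 1) s ∧
    deriv (Inu 1) s =
      s * deriv (Inu 0) s + (1 / 4) * Inu 0 s + 1 / (2 * Real.sqrt (1 + s)) := by
  refine ⟨(hasDerivAt_Inu 0 hs).differentiableAt, (hasDerivAt_Inu 1 hs).differentiableAt, ?_⟩
  rw [(hasDerivAt_Inu 0 hs).deriv, (hasDerivAt_Inu 1 hs).deriv, Inu_eq]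
  have h := integral_deriv_combination hs
  have h2 : 1 / √2 * (1 / 2 * (√2 / √(1 + s))) = 1 / (2 * √(1 + s)) := by
    have : √(1 + s) ≠ 0 := by positivity
    field_simp
  rw [← h2, ← h]
  ring
end
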